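/- arXiv:0905.3662 — 3 statements merged into one kernel-verified Lean document; each statement's English description precedes it below -/
import Mathlib

section
/- For every (ξ₁₂, ξ₁₃, ξ₂₃) ∈ ℂ³, the real 6×6 matrix A = A(ξ₁₂,ξ₁₃,ξ₂₃) is invertible, and the matrix J = A·𝕁·A⁻¹ is a skew-symmetric orthogonal complex structure on ℝ⁶: it satisfies Jᵀ = −J, JᵀJ = I and J² = −I. -/
open Matrix

/-- The real `6×6` matrix `A(ξ₁₂,ξ₁₃,ξ₂₃)` (with `ξ_{ij} = f_{ij} + i g_{ij}`). -/
def Amat (a b c : ℂ) : Matrix (Fin 6) (Fin 6) ℝ :=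
  !![-1, 0, a.re, a.im, b.re, b.im;
     0, -1, a.im, -a.re, b.im, -b.re;
     -a.re, -a.im, -1, 0, c.re, c.im;
     -a.im, a.re, 0, -1, c.im, -c.re;
     -b.re, -b.im, -c.re, -c.im, -1, 0;
     -b.im, b.re, -c.im, c.re, 0, -1]

/-- The standard complex structure `𝕁 = blockdiag(J₀,J₀,J₀)` on `ℝ⁶`. -/
def stdJ : Matrix (Fin 6) (Fin 6) ℝ :=
  !![0, -1, 0, 0, 0, 0;
     1, 0, 0, 0, 0, 0;
     0, 0, 0, -1, 0, 0;
     0, 0, 1, 0, 0, 0;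
     0, 0, 0, 0, 0, -1;
     0, 0, 0, 0, 1, 0]

theorem Amat_transpose (a b c : ℂ) : (Amat a b c)ᵀ = -2 - Amat a b c := by
  ext i j
  fin_cases i <;> fin_cases j <;> norm_num [Amat, ofNat_apply]

theorem stdJ_transpose : stdJᵀ = -stdJ := by
  ext i j
  fin_cases i <;> fin_cases j <;> simp [stdJ]

theorem stdJ_mul_self : stdJ * stdJ = -1 := by
  ext i j
  fin_cases i <;> fin_cases j <;> simp [stdJ, mul_apply, Fin.sum_univ_succ]

theorem Amat_mul_stdJ (a b c : ℂ) : Amat a b c * stdJ = stdJ * (Amat a b c)ᵀ := by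
  ext i j
  fin_cases i <;> fin_cases j <;> simp [Amat, stdJ, mul_apply, Fin.sum_univ_succ]

theorem isUnit_Amat (a b c : ℂ) : IsUnit (Amat a b c) := by
  have h : Amat a b c * (Amat a b c)ᵀ = 1 + (Amat a b c + 1) * (Amat a b c + 1)ᴴ := by
    rw [conjTranspose_eq_transpose_of_trivial, transpose_add, transpose_one, Amat_transpose]
    noncomm_ring
  have hpos : (Amat a b c * (Amat a b c)ᵀ).PosDef :=
    h ▸ PosDef.one.add_posSemidef (posSemidef_self_mul_conjTranspose _)
  have hdet := (isUnit_iff_isUnit_det _).1 hpos.isUnit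
  rw [det_mul] at hdet
  exact (isUnit_iff_isUnit_det _).2 (isUnit_of_mul_isUnit_left hdet)

theorem Amat_conj_mul_self (a b c : ℂ) :
    (Amat a b c * stdJ * (Amat a b c)⁻¹) * (Amat a b c * stdJ * (Amat a b c)⁻¹) = -1 := by
  have hdet := (isUnit_iff_isUnit_det _).1 (isUnit_Amat a b c)
  calc _ = Amat a b c * stdJ * ((Amat a b c)⁻¹ * Amat a b c) * stdJ * (Amat a b c)⁻¹ := by
        simp only [Matrix.mul_assoc]
    _ = Amat a b c * (stdJ * stdJ) * (Amat a b c)⁻¹ := by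
        rw [nonsing_inv_mul _ hdet, Matrix.mul_one, Matrix.mul_assoc (Amat a b c)]
    _ = -1 := by
        rw [stdJ_mul_self, Matrix.mul_neg, Matrix.mul_one, Matrix.neg_mul, mul_nonsing_inv _ hdet]

theorem Amat_conj_transpose (a b c : ℂ) :
    (Amat a b c * stdJ * (Amat a b c)⁻¹)ᵀ = -(Amat a b c * stdJ * (Amat a b c)⁻¹) := by
  have hdet := (isUnit_iff_isUnit_det _).1 (isUnit_Amat a b c)
  have hdetT : IsUnit (Amat a b c)ᵀ.det := by rwa [det_transpose]
  have hcomm : Amat a b c * (Amat a b c)ᵀ = (Amat a b c)ᵀ * Amat a b c := by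
    rw [Amat_transpose]
    noncomm_ring
  have hJA : stdJ * Amat a b c = (Amat a b c)ᵀ * stdJ := by
    have h := Amat_mul_stdJ a b c
    rw [Amat_transpose] at h ⊢
    rw [sub_mul, h]
    noncomm_ring
  have hkey : Amat a b c * stdJ * Amat a b c = (Amat a b c)ᵀ * (Amat a b c * stdJ) := by
    rw [Matrix.mul_assoc, hJA, ← Matrix.mul_assoc, hcomm, Matrix.mul_assoc]
  have hconj : (Amat a b c)ᵀ⁻¹ * (Amat a b c * stdJ) = Amat a b c * stdJ * (Amat a b c)⁻¹ := by
    calc _ = (Amat a b c)ᵀ⁻¹ * (Amat a b c * stdJ * Amat a b c) * (Amat a b c)⁻¹ := by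
          rw [← Matrix.mul_assoc _ _ (Amat a b c), mul_nonsing_inv_cancel_right _ _ hdet]
      _ = _ := by
          rw [hkey, nonsing_inv_mul_cancel_left _ _ hdetT]
  rw [transpose_mul, transpose_mul, stdJ_transpose, transpose_nonsing_inv, Matrix.neg_mul,
    ← Amat_mul_stdJ, Matrix.mul_neg, hconj]

/-- For all `(ξ₁₂,ξ₁₃,ξ₂₃) ∈ ℂ³` the matrix `A` is invertible, and `J = A·𝕁·A⁻¹` is a
skew-symmetric orthogonal complex structure on `ℝ⁶`. -/
theorem Amat_conj_is_OCS (a b c : ℂ) :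
    IsUnit (Amat a b c) ∧
    (Amat a b c * stdJ * (Amat a b c)⁻¹)ᵀ = -(Amat a b c * stdJ * (Amat a b c)⁻¹) ∧
    (Amat a b c * stdJ * (Amat a b c)⁻¹)ᵀ * (Amat a b c * stdJ * (Amat a b c)⁻¹) = 1 ∧
    (Amat a b c * stdJ * (Amat a b c)⁻¹) * (Amat a b c * stdJ * (Amat a b c)⁻¹) = -1 := by
  refine ⟨isUnit_Amat a b c, Amat_conj_transpose a b c, ?_, Amat_conj_mul_self a b c⟩
  rw [Amat_conj_transpose, Matrix.neg_mul, Amat_conj_mul_self, neg_neg]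
end

section
/- The map Φ : ℙ³(ℂ) × ℂ³ → ℙ(ℂ⁴ × ℂ⁴) = ℙ(ℂ⁸) defined by Φ([ξ], z) = [(ξ, M(z)ξ)] is well defined and is a homeomorphism onto the set {[(ξ,W)] ∈ ℙ(ℂ⁴×ℂ⁴) : Σ_{i=1}^{4} ξ_i W_i = 0 and ξ ≠ 0}; that is, Φ is a homeomorphism from ℙ³(ℂ) × ℂ³ onto the complement, in the quadric Q = {[(ξ,W)] : Σ_i ξ_i W_i = 0}, of the linear subspace ℙ({0} × ℂ⁴). -/
open Matrix

noncomputable instance projTop {K V : Type*} [DivisionRing K] [AddCommGroup V] [Module K V]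
    [TopologicalSpace V] : TopologicalSpace (Projectivization K V) :=
  inferInstanceAs (TopologicalSpace (Quotient _))

/-- The skew-symmetric matrix `M(z)`, `z ∈ ℂ³`, representing Clifford multiplication. -/
noncomputable def Mz (z : Fin 3 → ℂ) : Matrix (Fin 4) (Fin 4) ℂ :=
  !![0, -z 2, -z 1, -z 0;
     z 2, 0, -(starRingEnd ℂ) (z 0), (starRingEnd ℂ) (z 1);
     z 1, (starRingEnd ℂ) (z 0), 0, -(starRingEnd ℂ) (z 2);
     z 0, -(starRingEnd ℂ) (z 1), (starRingEnd ℂ) (z 2), 0]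

/-- The part of the twistor quadric `Q = {[(ξ,W)] : Σ ξᵢWᵢ = 0}` lying over `ℝ⁶`,
i.e. with `ξ ≠ 0` (the complement of the fiber `ℙ({0} × ℂ⁴)` over infinity). -/
def quadricFinite : Set (Projectivization ℂ ((Fin 4 → ℂ) × (Fin 4 → ℂ))) :=
  {p | (∑ i, p.rep.1 i * p.rep.2 i) = 0 ∧ p.rep.1 ≠ 0}

section Topology

variable {K V : Type*} [DivisionRing K] [AddCommGroup V] [Module K V] [TopologicalSpace V]

theorem Projectivization.isOpenQuotientMap_mk' [ContinuousConstSMul K V] :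
    IsOpenQuotientMap (Projectivization.mk' K : {v : V // v ≠ 0} → Projectivization K V) := by
  have hq : Topology.IsQuotientMap
      (Projectivization.mk' K : {v : V // v ≠ 0} → Projectivization K V) := isQuotientMap_quot_mk
  refine ⟨hq.surjective, hq.continuous, fun U hU => ?_⟩
  rw [← hq.isOpen_preimage]
  have h : Projectivization.mk' K ⁻¹' (Projectivization.mk' K '' U) =
      ⋃ c : Kˣ, (fun v : {v : V // v ≠ 0} =>
        (⟨c • v.1, (smul_ne_zero_iff_ne c).2 v.2⟩ : {v : V // v ≠ 0})) ⁻¹' U := by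
    ext v
    simp only [Set.mem_preimage, Set.mem_image, Set.mem_iUnion]
    constructor
    · rintro ⟨w, hw, hwv⟩
      obtain ⟨c, hc⟩ := (Projectivization.mk_eq_mk_iff K w.1 v.1 w.2 v.2).1 hwv
      exact ⟨c, by simpa only [hc] using hw⟩
    · rintro ⟨c, hc⟩
      exact ⟨_, hc, (Projectivization.mk_eq_mk_iff K _ _ _ v.2).2 ⟨c, rfl⟩⟩
  rw [h]
  refine isOpen_iUnion fun c => hU.preimage (Continuous.subtype_mk ?_ _)
  exact (continuous_const_smul (c : K)).comp continuous_subtype_val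

end Topology

section Algebra

open ComplexConjugate

theorem Mz_mulVec (z : Fin 3 → ℂ) (ξ : Fin 4 → ℂ) :
    Mz z *ᵥ ξ = ![-z 2 * ξ 1 - z 1 * ξ 2 - z 0 * ξ 3,
      z 2 * ξ 0 - conj (z 0) * ξ 2 + conj (z 1) * ξ 3,
      z 1 * ξ 0 + conj (z 0) * ξ 1 - conj (z 2) * ξ 3,
      z 0 * ξ 0 - conj (z 1) * ξ 1 + conj (z 2) * ξ 2] := by
  ext i
  fin_cases i <;> simp [Mz, Matrix.mulVec, dotProduct, Fin.sum_univ_four] <;> ring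

theorem sum_mul_Mz_mulVec (z : Fin 3 → ℂ) (ξ : Fin 4 → ℂ) :
    ∑ i, ξ i * (Mz z *ᵥ ξ) i = 0 := by
  simp [Mz_mulVec, Fin.sum_univ_four]
  ring

/-- The Hermitian square norm of a vector of `ℂ⁴`, as a complex number. -/
noncomputable def hermSq (ξ : Fin 4 → ℂ) : ℂ := ∑ i, conj (ξ i) * ξ i

theorem hermSq_ne_zero {ξ : Fin 4 → ℂ} (hξ : ξ ≠ 0) : hermSq ξ ≠ 0 := by
  intro h
  open ComplexOrder in exact hξ (dotProduct_star_self_eq_zero.1 h)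

/-- The adjoint of the real-linear map `z ↦ M(z)ξ`, divided by `|ξ|²`: this recovers `z` from
`(ξ, M(z)ξ)`. -/
noncomputable def MzInv (v : (Fin 4 → ℂ) × (Fin 4 → ℂ)) : Fin 3 → ℂ :=
  ![(conj (v.1 0) * v.2 3 - conj (v.1 3) * v.2 0 + v.1 1 * conj (v.2 2) - v.1 2 * conj (v.2 1))
      / hermSq v.1,
    (conj (v.1 0) * v.2 2 - conj (v.1 2) * v.2 0 + v.1 3 * conj (v.2 1) - v.1 1 * conj (v.2 3))
      / hermSq v.1,
    (conj (v.1 0) * v.2 1 - conj (v.1 1) * v.2 0 + v.1 2 * conj (v.2 3) - v.1 3 * conj (v.2 2))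
      / hermSq v.1]

theorem conj_hermSq (ξ : Fin 4 → ℂ) : conj (hermSq ξ) = hermSq ξ := by
  simp [hermSq, mul_comm]

theorem MzInv_smul {c : ℂ} (hc : c ≠ 0) (v : (Fin 4 → ℂ) × (Fin 4 → ℂ)) :
    MzInv (c • v) = MzInv v := by
  have hc' : conj c ≠ 0 := by simpa using hc
  have h : hermSq (c • v.1) = (conj c * c) * hermSq v.1 := by
    simp [hermSq, Fin.sum_univ_four]
    ring
  have key : ∀ a b : ℂ, a = (conj c * c) * b →
      a / ((conj c * c) * hermSq v.1) = b / hermSq v.1 := by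
    rintro _ b rfl
    exact mul_div_mul_left _ _ (mul_ne_zero hc' hc)
  ext i
  fin_cases i <;> simp only [MzInv, Prod.smul_fst, Prod.smul_snd, h] <;>
    exact key _ _ (by simp; ring)

theorem MzInv_mulVec (z : Fin 3 → ℂ) {ξ : Fin 4 → ℂ} (hξ : ξ ≠ 0) :
    MzInv (ξ, Mz z *ᵥ ξ) = z := by
  have h := hermSq_ne_zero hξ
  ext i
  fin_cases i <;> simp [MzInv, Mz_mulVec] <;> rw [div_eq_iff h] <;>
    simp [hermSq, Fin.sum_univ_four] <;> ring

theorem Mz_MzInv_mulVec {ξ W : Fin 4 → ℂ} (hξ : ξ ≠ 0) (h : ∑ i, ξ i * W i = 0) :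
    Mz (MzInv (ξ, W)) *ᵥ ξ = W := by
  have hn := hermSq_ne_zero hξ
  have hW := congrArg conj h
  simp only [Fin.sum_univ_four, map_add, map_mul, map_zero] at h hW
  have hN : hermSq ξ = conj (ξ 0) * ξ 0 + conj (ξ 1) * ξ 1 + conj (ξ 2) * ξ 2
      + conj (ξ 3) * ξ 3 := by simp [hermSq, Fin.sum_univ_four]
  ext i
  fin_cases i <;> simp [MzInv, Mz_mulVec, conj_hermSq] <;> field_simp <;> rw [hN]
  · linear_combination (-conj (ξ 0)) * h
  · linear_combination (-conj (ξ 1)) * h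
  · linear_combination (-conj (ξ 2)) * h
  · linear_combination (-conj (ξ 3)) * h

theorem Mz_mulVec_smul (z : Fin 3 → ℂ) (c : ℂ) (ξ : Fin 4 → ℂ) :
    ((c • ξ, Mz z *ᵥ (c • ξ)) : (Fin 4 → ℂ) × (Fin 4 → ℂ)) = c • (ξ, Mz z *ᵥ ξ) := by
  rw [Matrix.mulVec_smul, Prod.smul_mk]

end Algebra

theorem mk_mem_quadricFinite {v : (Fin 4 → ℂ) × (Fin 4 → ℂ)} (hv : v ≠ 0) :
    Projectivization.mk ℂ v hv ∈ quadricFinite ↔ ∑ i, v.1 i * v.2 i = 0 ∧ v.1 ≠ 0 := by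
  obtain ⟨c, hc⟩ := Projectivization.exists_smul_eq_mk_rep ℂ v hv
  have hsum : ∑ i, (c • v).1 i * (c • v).2 i = (c : ℂ) ^ 2 * ∑ i, v.1 i * v.2 i := by
    rw [Finset.mul_sum]
    refine Finset.sum_congr rfl fun i _ => ?_
    simp only [Units.smul_def, Prod.smul_fst, Prod.smul_snd, Pi.smul_apply, smul_eq_mul]
    ring
  simp only [quadricFinite, Set.mem_ofPred_eq, ← hc, hsum]
  simp [Units.smul_def]

/-- The point `[(ξ, M(z)ξ)]` of the quadric, for a representative `ξ` of a point of `ℙ³(ℂ)`. -/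
noncomputable def twistorMap (x : Projectivization ℂ (Fin 4 → ℂ) × (Fin 3 → ℂ)) :
    quadricFinite :=
  ⟨Projectivization.mk ℂ (x.1.rep, Mz x.2 *ᵥ x.1.rep)
      (fun h => x.1.rep_nonzero (congrArg Prod.fst h)),
    (mk_mem_quadricFinite _).2 ⟨sum_mul_Mz_mulVec _ _, x.1.rep_nonzero⟩⟩

theorem twistorMap_mk (ξ : Fin 4 → ℂ) (hξ : ξ ≠ 0) (z : Fin 3 → ℂ) :
    (twistorMap (Projectivization.mk ℂ ξ hξ, z)).1 =
      Projectivization.mk ℂ (ξ, Mz z *ᵥ ξ) (fun h => hξ (congrArg Prod.fst h)) := by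
  obtain ⟨c, hc⟩ := Projectivization.exists_smul_eq_mk_rep ℂ ξ hξ
  refine (Projectivization.mk_eq_mk_iff ℂ _ _ _ _).2 ⟨c, ?_⟩
  rw [← hc]
  exact (Mz_mulVec_smul z (c : ℂ) ξ).symm

/-- The inverse of `twistorMap`, sending `[(ξ, W)]` to `([ξ], z)` with `M(z)ξ = W`. -/
noncomputable def twistorInv (q : quadricFinite) :
    Projectivization ℂ (Fin 4 → ℂ) × (Fin 3 → ℂ) :=
  (Projectivization.mk ℂ q.1.rep.1 q.2.2, MzInv q.1.rep)

theorem twistorInv_mk {v : (Fin 4 → ℂ) × (Fin 4 → ℂ)} (hv : v ≠ 0)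
    (h : Projectivization.mk ℂ v hv ∈ quadricFinite) :
    twistorInv ⟨Projectivization.mk ℂ v hv, h⟩ =
      (Projectivization.mk ℂ v.1 ((mk_mem_quadricFinite hv).1 h).2, MzInv v) := by
  obtain ⟨c, hc⟩ := Projectivization.exists_smul_eq_mk_rep ℂ v hv
  refine Prod.ext ((Projectivization.mk_eq_mk_iff ℂ _ _ _ _).2 ⟨c, ?_⟩) ?_
  · exact congrArg Prod.fst hc
  · exact (congrArg MzInv hc).symm.trans (MzInv_smul c.ne_zero v)

theorem twistorInv_twistorMap (x : Projectivization ℂ (Fin 4 → ℂ) × (Fin 3 → ℂ)) :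
    twistorInv (twistorMap x) = x := by
  refine (twistorInv_mk _ _).trans (Prod.ext x.1.mk_rep ?_)
  exact MzInv_mulVec x.2 x.1.rep_nonzero

theorem twistorMap_twistorInv (q : quadricFinite) : twistorMap (twistorInv q) = q := by
  refine Subtype.ext ((twistorMap_mk _ q.2.2 _).trans ?_)
  simp only [Mz_MzInv_mulVec q.2.2 q.2.1, Prod.mk.eta, Projectivization.mk_rep]

theorem continuous_Mz : Continuous Mz := by
  refine continuous_matrix fun i j => ?_
  fin_cases i <;> fin_cases j <;> simp [Mz] <;> fun_prop

theorem continuous_twistorMap : Continuous twistorMap := by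
  have hq := (Projectivization.isOpenQuotientMap_mk' (K := ℂ) (V := Fin 4 → ℂ)).prodMap
    (IsOpenQuotientMap.id (X := Fin 3 → ℂ))
  refine hq.isQuotientMap.continuous_iff.2 (continuous_induced_rng.2 ?_)
  have hc : Continuous fun x : {ξ : Fin 4 → ℂ // ξ ≠ 0} × (Fin 3 → ℂ) =>
      (⟨(x.1.1, Mz x.2 *ᵥ x.1.1), fun h => x.1.2 (congrArg Prod.fst h)⟩ :
        {v : (Fin 4 → ℂ) × (Fin 4 → ℂ) // v ≠ 0}) := by
    have h₁ : Continuous fun x : {ξ : Fin 4 → ℂ // ξ ≠ 0} × (Fin 3 → ℂ) => x.1.1 := by fun_prop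
    exact Continuous.subtype_mk
      (h₁.prodMk ((continuous_Mz.comp continuous_snd).matrix_mulVec h₁)) _
  convert (Projectivization.isOpenQuotientMap_mk' (K := ℂ)
    (V := (Fin 4 → ℂ) × (Fin 4 → ℂ))).continuous.comp hc using 1
  funext x
  exact twistorMap_mk x.1.1 x.1.2 x.2

theorem continuousOn_MzInv : ContinuousOn MzInv {v | v.1 ≠ 0} := by
  have h : Continuous hermSq := by unfold hermSq; fun_prop
  refine continuousOn_pi.2 fun i => ?_
  fin_cases i <;>
    exact ContinuousOn.div (by fun_prop) (h.comp continuous_fst).continuousOn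
      fun v hv => hermSq_ne_zero hv

theorem continuous_twistorInv : Continuous twistorInv := by
  have hp := Projectivization.isOpenQuotientMap_mk' (K := ℂ) (V := (Fin 4 → ℂ) × (Fin 4 → ℂ))
  have hq : IsOpenQuotientMap (quadricFinite.restrictPreimage (Projectivization.mk' ℂ)) :=
    ⟨Set.restrictPreimage_surjective _ hp.surjective, hp.continuous.restrictPreimage,
      hp.isOpenMap.restrictPreimage _⟩
  refine hq.isQuotientMap.continuous_iff.2 ?_
  have hne (x : Projectivization.mk' ℂ ⁻¹' quadricFinite) : x.1.1.1 ≠ 0 :=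
    ((mk_mem_quadricFinite x.1.2).1 x.2).2
  have h₁ : Continuous fun x : Projectivization.mk' ℂ ⁻¹' quadricFinite =>
      (⟨x.1.1.1, hne x⟩ : {ξ : Fin 4 → ℂ // ξ ≠ 0}) :=
    Continuous.subtype_mk (by fun_prop) _
  have h₂ : Continuous fun x : Projectivization.mk' ℂ ⁻¹' quadricFinite => MzInv x.1.1 :=
    continuousOn_MzInv.comp_continuous (by fun_prop) hne
  convert ((Projectivization.isOpenQuotientMap_mk' (K := ℂ)
    (V := Fin 4 → ℂ)).continuous.comp h₁).prodMk h₂ using 1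
  funext x
  exact twistorInv_mk x.1.2 x.2

/-- The map `Φ([ξ], z) = [(ξ, M(z)ξ)]` is well defined and a homeomorphism from
`ℙ³(ℂ) × ℂ³` onto the complement of `ℙ({0} × ℂ⁴)` in the twistor quadric. -/
theorem twistor_coordinates_homeomorph :
    ∃ Φ : (Projectivization ℂ (Fin 4 → ℂ) × (Fin 3 → ℂ)) ≃ₜ quadricFinite,
      ∀ (ξ : Fin 4 → ℂ) (hξ : ξ ≠ 0) (z : Fin 3 → ℂ),
        (Φ (Projectivization.mk ℂ ξ hξ, z)).1
          = Projectivization.mk ℂ (ξ, (Mz z).mulVec ξ)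
              (fun h => hξ (congrArg Prod.fst h)) := by
  exact ⟨{ toFun := twistorMap
           invFun := twistorInv
           left_inv := twistorInv_twistorMap
           right_inv := twistorMap_twistorInv
           continuous_toFun := continuous_twistorMap
           continuous_invFun := continuous_twistorInv }, twistorMap_mk⟩
end

section
/- For every D ∈ SU(4) (i.e. conj(D)ᵀD = I and det D = 1), there is a unique map ρ_D : ℂ³ → ℂ³ such that D·M(z)·Dᵀ = M(ρ_D(z)) for all z ∈ ℂ³. The map ρ_D is ℝ-linear, norm-preserving (‖ρ_D(z)‖ = ‖z‖ for all z), and orientation-preserving: its determinant as an ℝ-linear automorphism of ℂ³ ≅ ℝ⁶ equals 1. Conversely, for every ℝ-linear isometry R of ℂ³ ≅ ℝ⁶ with determinant 1 there exists D ∈ SU(4) with D·M(z)·Dᵀ = M(R(z)) for all z ∈ ℂ³. (This realizes the double covering SU(4) ≅ Spin(6) → SO(6).) -/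
open Matrix

/-- The Hodge dual of a skew-symmetric `4 × 4` matrix. -/
def skewDual (A : Matrix (Fin 4) (Fin 4) ℂ) : Matrix (Fin 4) (Fin 4) ℂ :=
  !![0, A 2 3, -A 1 3, A 1 2;
     -A 2 3, 0, A 0 3, -A 0 2;
     A 1 3, -A 0 3, 0, A 0 1;
     -A 1 2, A 0 2, -A 0 1, 0]

lemma transpose_Mz (z : Fin 3 → ℂ) : (Mz z)ᵀ = -Mz z := by
  ext i j; fin_cases i <;> fin_cases j <;> simp [Mz]

lemma skewDual_Mz (z : Fin 3 → ℂ) : skewDual (Mz z) = (Mz z).map (starRingEnd ℂ) := by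
  ext i j; fin_cases i <;> fin_cases j <;> simp [Mz, skewDual]

lemma eq_Mz_of_skewDual {A : Matrix (Fin 4) (Fin 4) ℂ} (hA : Aᵀ = -A)
    (h : skewDual A = A.map (starRingEnd ℂ)) : A = Mz ![A 3 0, A 2 0, A 1 0] := by
  have hs : ∀ i j, A j i = -A i j := fun i j => congrFun (congrFun hA i) j
  have hd : ∀ i, A i i = 0 := fun i => self_eq_neg.mp (hs i i)
  have h12 : -A 1 2 = (starRingEnd ℂ) (A 3 0) := congrFun (congrFun h 3) 0
  have h13 : A 1 3 = (starRingEnd ℂ) (A 2 0) := congrFun (congrFun h 2) 0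
  have h23 : -A 2 3 = (starRingEnd ℂ) (A 1 0) := congrFun (congrFun h 1) 0
  rw [neg_eq_iff_eq_neg] at h12 h23
  have h21 := hs 1 2
  have h31 := hs 1 3
  have h32 := hs 2 3
  rw [h12] at h21
  rw [h13] at h31
  rw [h23] at h32
  ext i j
  fin_cases i <;> fin_cases j <;>
    simp [Mz, hd, h12, h13, h23, h21, h31, h32, hs 1 0, hs 2 0, hs 3 0]

lemma transpose_mul_skewDual_mul (D A : Matrix (Fin 4) (Fin 4) ℂ) (hA : Aᵀ = -A) :
    Dᵀ * skewDual (D * A * Dᵀ) * D = D.det • skewDual A := by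
  have hs : ∀ i j, A j i = -A i j := fun i j => congrFun (congrFun hA i) j
  have hd : ∀ i, A i i = 0 := fun i => self_eq_neg.mp (hs i i)
  have hdet : D.det = ∑ j : Fin 4, (-1) ^ (j : ℕ) * D 0 j *
      (D.submatrix Fin.succ (Fin.succAbove j)).det := det_succ_row_zero D
  simp [Fin.sum_univ_succ, det_fin_three, Fin.succAbove] at hdet
  ext i j
  rw [hdet]
  clear hdet
  fin_cases i <;> fin_cases j <;>
    simp [skewDual, Matrix.mul_apply, Fin.sum_univ_four]
  all_goals simp only [hd, hs 0 1, hs 0 2, hs 0 3, hs 1 2, hs 1 3, hs 2 3]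
  all_goals ring

lemma Mz_mul_conj (z : Fin 3 → ℂ) :
    Mz z * (Mz z).map (starRingEnd ℂ) = -((∑ i, Complex.normSq (z i) : ℝ) : ℂ) • 1 := by
  ext i j
  fin_cases i <;> fin_cases j <;>
    simp [Mz, Matrix.mul_apply, Fin.sum_univ_succ, Complex.normSq_eq_conj_mul_self] <;> ring

lemma det_Mz (z : Fin 3 → ℂ) : (Mz z).det = ((∑ i, Complex.normSq (z i) : ℝ) : ℂ) ^ 2 := by
  simp [Mz, det_succ_row_zero, Fin.sum_univ_succ, Fin.succAbove,
    Complex.normSq_eq_conj_mul_self]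
  ring

lemma Mz_mul_conj_mul (v z : Fin 3 → ℂ) :
    Mz v * (Mz z).map (starRingEnd ℂ) * Mz v =
      ((∑ i, Complex.normSq (v i) : ℝ) : ℂ) • Mz z -
        ((∑ i, (z i * (starRingEnd ℂ) (v i) + v i * (starRingEnd ℂ) (z i)) : ℂ)) • Mz v := by
  ext i j
  rw [Matrix.sub_apply, Matrix.smul_apply, Matrix.smul_apply, mul_apply, Fin.sum_univ_four]
  simp only [mul_apply, Fin.sum_univ_four]
  fin_cases i <;> fin_cases j <;>
    simp [Mz, Fin.sum_univ_succ, Complex.normSq_eq_conj_mul_self] <;> ring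

lemma mem_specialUnitaryGroup_iff_map {D : Matrix (Fin 4) (Fin 4) ℂ} :
    D ∈ specialUnitaryGroup (Fin 4) ℂ ↔ (D.map (starRingEnd ℂ))ᵀ * D = 1 ∧ D.det = 1 := by
  rw [mem_specialUnitaryGroup_iff, mem_unitaryGroup_iff']
  rfl

lemma map_mul_transpose_of_mem {D : Matrix (Fin 4) (Fin 4) ℂ}
    (hD : D ∈ specialUnitaryGroup (Fin 4) ℂ) : D.map (starRingEnd ℂ) * Dᵀ = 1 := by
  have h := mul_eq_one_comm.mp (mem_specialUnitaryGroup_iff_map.mp hD).1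
  simpa using congrArg transpose h

lemma transpose_mul_map_of_mem {D : Matrix (Fin 4) (Fin 4) ℂ}
    (hD : D ∈ specialUnitaryGroup (Fin 4) ℂ) : Dᵀ * D.map (starRingEnd ℂ) = 1 :=
  mul_eq_one_comm.mp (map_mul_transpose_of_mem hD)

lemma map_map_starRingEnd (A : Matrix (Fin 4) (Fin 4) ℂ) :
    (A.map (starRingEnd ℂ)).map (starRingEnd ℂ) = A := by
  ext; simp

lemma map_mem_specialUnitaryGroup {D : Matrix (Fin 4) (Fin 4) ℂ}
    (hD : D ∈ specialUnitaryGroup (Fin 4) ℂ) :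
    D.map (starRingEnd ℂ) ∈ specialUnitaryGroup (Fin 4) ℂ := by
  refine mem_specialUnitaryGroup_iff_map.mpr ⟨?_, ?_⟩
  · rw [map_map_starRingEnd, transpose_mul_map_of_mem hD]
  · have := (starRingEnd ℂ).map_det D
    rw [(mem_specialUnitaryGroup_iff_map.mp hD).2, map_one] at this
    exact this.symm

lemma congr_Mz_eq_Mz {D : Matrix (Fin 4) (Fin 4) ℂ}
    (hD : D ∈ specialUnitaryGroup (Fin 4) ℂ) (z : Fin 3 → ℂ) :
    D * Mz z * Dᵀ =
      Mz ![(D * Mz z * Dᵀ) 3 0, (D * Mz z * Dᵀ) 2 0, (D * Mz z * Dᵀ) 1 0] := by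
  apply eq_Mz_of_skewDual
  · simp [transpose_mul, transpose_Mz, Matrix.mul_assoc]
  · have h := transpose_mul_skewDual_mul D (Mz z) (transpose_Mz z)
    rw [(mem_specialUnitaryGroup_iff_map.mp hD).2, one_smul, skewDual_Mz] at h
    rw [Matrix.map_mul, Matrix.map_mul, ← h]
    have h1 := map_mul_transpose_of_mem hD
    have h2 := mul_eq_one_comm.mp (mem_specialUnitaryGroup_iff_map.mp hD).1
    rw [← transpose_map] at h2
    calc _ = D.map (starRingEnd ℂ) * Dᵀ * skewDual (D * Mz z * Dᵀ) *
          (D * Dᵀ.map (starRingEnd ℂ)) := by rw [h1, h2, Matrix.one_mul, Matrix.mul_one]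
      _ = _ := by simp only [Matrix.mul_assoc]

lemma Mz_injective : Function.Injective Mz := by
  intro z w h
  have h0 := congrFun (congrFun h 3) 0
  have h1 := congrFun (congrFun h 2) 0
  have h2 := congrFun (congrFun h 1) 0
  ext i
  fin_cases i
  exacts [h0, h1, h2]

lemma sum_normSq_eq_of_congr {D : Matrix (Fin 4) (Fin 4) ℂ}
    (hD : D ∈ specialUnitaryGroup (Fin 4) ℂ) {z w : Fin 3 → ℂ}
    (h : D * Mz z * Dᵀ = Mz w) :
    ∑ i, Complex.normSq (w i) = ∑ i, Complex.normSq (z i) := by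
  have h1 := transpose_mul_map_of_mem hD
  have h2 := mul_eq_one_comm.mp (mem_specialUnitaryGroup_iff_map.mp hD).1
  have key : Mz w * (Mz w).map (starRingEnd ℂ) =
      D * (Mz z * (Mz z).map (starRingEnd ℂ)) * (D.map (starRingEnd ℂ))ᵀ := by
    rw [← h, Matrix.map_mul, Matrix.map_mul, transpose_map]
    calc _ = D * Mz z * (Dᵀ * D.map (starRingEnd ℂ)) * (Mz z).map (starRingEnd ℂ) *
          (D.map (starRingEnd ℂ))ᵀ := by simp only [Matrix.mul_assoc]
      _ = _ := by rw [h1]; simp only [Matrix.mul_assoc, Matrix.one_mul]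
  rw [Mz_mul_conj, Mz_mul_conj, Matrix.mul_smul, Matrix.mul_one, Matrix.smul_mul, h2] at key
  have := congrFun (congrFun key 0) 0
  simpa only [Matrix.smul_apply, one_apply_eq, smul_eq_mul, mul_one, neg_inj,
    Complex.ofReal_inj] using this

lemma exists_congr_Mz_ne_map (E : Matrix (Fin 4) (Fin 4) ℂ) :
    ∃ z, E * Mz z * Eᵀ ≠ (Mz z).map (starRingEnd ℂ) := by
  by_contra! h
  have H0 : ∀ i j, -2 * (E i 0 * E j 3 - E i 3 * E j 0) =
      (Mz ![1, 0, 0]).map (starRingEnd ℂ) i j -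
        Complex.I * (Mz ![Complex.I, 0, 0]).map (starRingEnd ℂ) i j := by
    intro i j
    rw [← h, ← h]
    simp [Matrix.mul_apply, Fin.sum_univ_four, Mz]
    linear_combination -(E i 2 * E j 1 - E i 1 * E j 2 + E i 0 * E j 3 - E i 3 * E j 0) * Complex.I_sq
  have H1 : ∀ i j, -2 * (E i 0 * E j 2 - E i 2 * E j 0) =
      (Mz ![0, 1, 0]).map (starRingEnd ℂ) i j -
        Complex.I * (Mz ![0, Complex.I, 0]).map (starRingEnd ℂ) i j := by
    intro i j
    rw [← h, ← h]
    simp [Matrix.mul_apply, Fin.sum_univ_four, Mz]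
    linear_combination -(E i 1 * E j 3 - E i 3 * E j 1 + E i 0 * E j 2 - E i 2 * E j 0) * Complex.I_sq
  have H2 : ∀ i j, -2 * (E i 0 * E j 1 - E i 1 * E j 0) =
      (Mz ![0, 0, 1]).map (starRingEnd ℂ) i j -
        Complex.I * (Mz ![0, 0, Complex.I]).map (starRingEnd ℂ) i j := by
    intro i j
    rw [← h, ← h]
    simp [Matrix.mul_apply, Fin.sum_univ_four, Mz]
    linear_combination -(E i 3 * E j 2 - E i 2 * E j 3 + E i 0 * E j 1 - E i 1 * E j 0) * Complex.I_sq
  have p12 := H0 1 2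
  have p13 := H0 1 3
  have p23 := H0 2 3
  have q12 := H1 1 2
  have q13 := H1 1 3
  have q23 := H1 2 3
  have r12 := H2 1 2
  have r13 := H2 1 3
  have r23 := H2 2 3
  simp [Mz] at p12 p13 p23 q12 q13 q23 r12 r13 r23
  have hq : E 2 0 = 0 := by
    grind
  have hr : E 1 0 = 0 := by
    grind
  rw [hq, hr] at p12
  norm_num at p12

lemma smul_Mz (a : ℝ) (z : Fin 3 → ℂ) : (a : ℂ) • Mz z = Mz (a • z) := by
  ext i j; fin_cases i <;> fin_cases j <;> simp [Mz]

lemma Mz_sub (z w : Fin 3 → ℂ) : Mz (z - w) = Mz z - Mz w := by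
  ext i j; fin_cases i <;> fin_cases j <;> simp [Mz] <;> ring

lemma Mz_add (z w : Fin 3 → ℂ) : Mz (z + w) = Mz z + Mz w := by
  ext i j; fin_cases i <;> fin_cases j <;> simp [Mz] <;> ring

lemma sum_normSq_eq_norm_sq (v : EuclideanSpace ℂ (Fin 3)) :
    ∑ i, Complex.normSq (v i) = ‖v‖ ^ 2 := by
  simp [EuclideanSpace.norm_sq_eq, Complex.normSq_eq_norm_sq]

lemma smul_Mz_mem_specialUnitaryGroup {v : EuclideanSpace ℂ (Fin 3)} (hv : v ≠ 0) :
    (Complex.I / (‖v‖ : ℂ)) • Mz v ∈ specialUnitaryGroup (Fin 4) ℂ := by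
  have hn : (‖v‖ : ℂ) ≠ 0 := by simpa using hv
  have hI : Complex.I ^ 4 = 1 := Complex.I_pow_four
  refine mem_specialUnitaryGroup_iff_map.mpr ⟨mul_eq_one_comm.mp ?_, ?_⟩
  · have h : ((Complex.I / (‖v‖ : ℂ)) • Mz v).map (starRingEnd ℂ) =
        -(Complex.I / (‖v‖ : ℂ)) • (Mz v).map (starRingEnd ℂ) := by
      ext; simp [neg_div]
    rw [h, transpose_smul, ← transpose_map, transpose_Mz]
    have h' : (-Mz v).map (starRingEnd ℂ) = -(Mz v).map (starRingEnd ℂ) := by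
      ext; simp
    rw [h', Matrix.smul_mul, Matrix.mul_smul, Matrix.mul_neg, Mz_mul_conj, sum_normSq_eq_norm_sq,
      ← neg_smul, smul_smul, smul_smul]
    convert one_smul ℂ _
    push_cast
    field_simp
    simp
  · rw [det_smul, det_Mz, sum_normSq_eq_norm_sq, Fintype.card_fin, div_pow, hI]
    push_cast
    field_simp

lemma smul_Mz_congr_map {v : EuclideanSpace ℂ (Fin 3)} (hv : v ≠ 0)
    (z : EuclideanSpace ℂ (Fin 3)) :
    (Complex.I / (‖v‖ : ℂ)) • Mz v * (Mz z).map (starRingEnd ℂ) *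
      ((Complex.I / (‖v‖ : ℂ)) • Mz v)ᵀ = Mz ((ℝ ∙ v)ᗮ.reflection z) := by
  have hn : (‖v‖ : ℂ) ≠ 0 := by simpa using hv
  have hi : (∑ i, (z i * (starRingEnd ℂ) (v i) + v i * (starRingEnd ℂ) (z i)) : ℂ) =
      ((2 * inner ℝ v z : ℝ) : ℂ) := by
    simp only [PiLp.inner_apply, Finset.mul_sum, Complex.ofReal_sum]
    refine Finset.sum_congr rfl fun i _ => ?_
    apply Complex.ext <;> simp [Complex.inner] <;> ring
  have hr : ((ℝ ∙ v)ᗮ.reflection z).ofLp =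
      z.ofLp - (2 * inner ℝ v z / ‖v‖ ^ 2) • v.ofLp := by
    rw [Submodule.reflection_orthogonal_apply, Submodule.reflection_singleton_apply]
    ext i
    simp [two_smul]
    ring
  rw [hr, Mz_sub, ← smul_Mz, transpose_smul, transpose_Mz, Matrix.smul_mul, Matrix.smul_mul,
    Matrix.mul_smul, Matrix.mul_neg, Mz_mul_conj_mul, sum_normSq_eq_norm_sq, hi, smul_neg, smul_neg,
    smul_smul, ← neg_smul, smul_sub, smul_smul, smul_smul]
  have hII : -(Complex.I / (‖v‖ : ℂ) * (Complex.I / ‖v‖)) = 1 / (‖v‖ : ℂ) ^ 2 := by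
    field_simp
    simp
  rw [hII]
  congr 1
  · convert one_smul ℂ _
    push_cast
    field_simp
  · congr 1
    push_cast
    ring

lemma det_prod_reflection_and_exists_congr (l : List (EuclideanSpace ℂ (Fin 3))) :
    (LinearMap.det (l.map fun v => (ℝ ∙ v)ᗮ.reflection).prod.toLinearMap = 1 ∧
      ∃ D ∈ specialUnitaryGroup (Fin 4) ℂ, ∀ z : EuclideanSpace ℂ (Fin 3),
        D * Mz z * Dᵀ = Mz ((l.map fun v => (ℝ ∙ v)ᗮ.reflection).prod z)) ∨
    (LinearMap.det (l.map fun v => (ℝ ∙ v)ᗮ.reflection).prod.toLinearMap = -1 ∧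
      ∃ D ∈ specialUnitaryGroup (Fin 4) ℂ, ∀ z : EuclideanSpace ℂ (Fin 3),
        D * (Mz z).map (starRingEnd ℂ) * Dᵀ =
          Mz ((l.map fun v => (ℝ ∙ v)ᗮ.reflection).prod z)) := by
  induction l with
  | nil =>
    refine Or.inl ⟨LinearMap.det_id, 1, one_mem _, fun z => ?_⟩
    simp
  | cons v l ih =>
    rw [List.map_cons, List.prod_cons]
    set φ := (l.map fun v => (ℝ ∙ v)ᗮ.reflection).prod
    by_cases hv : v = 0
    · have h1 : (ℝ ∙ v)ᗮ.reflection = 1 := by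
        ext1 x
        apply Submodule.reflection_mem_subspace_eq_self
        simp [hv]
      rwa [h1, one_mul]
    have hdet : LinearMap.det ((ℝ ∙ v)ᗮ.reflection * φ).toLinearMap =
        -LinearMap.det φ.toLinearMap := by
      have h : ((ℝ ∙ v)ᗮ.reflection * φ).toLinearMap =
        (ℝ ∙ v)ᗮ.reflection.toLinearMap * φ.toLinearMap := rfl
      rw [h, map_mul, Submodule.det_reflection, Submodule.orthogonal_orthogonal,
        finrank_span_singleton hv]
      simp
    have hmul : ∀ A D : Matrix (Fin 4) (Fin 4) ℂ,
        (Complex.I / (‖v‖ : ℂ)) • Mz v * (D * A * Dᵀ).map (starRingEnd ℂ) *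
          ((Complex.I / (‖v‖ : ℂ)) • Mz v)ᵀ =
        ((Complex.I / (‖v‖ : ℂ)) • Mz v * D.map (starRingEnd ℂ)) * A.map (starRingEnd ℂ) *
          ((Complex.I / (‖v‖ : ℂ)) • Mz v * D.map (starRingEnd ℂ))ᵀ := fun A D => by
      simp only [Matrix.map_mul, transpose_map, transpose_mul, Matrix.mul_assoc]
    have hE := smul_Mz_mem_specialUnitaryGroup hv
    rw [hdet]
    rcases ih with ⟨h, D, hD, hz⟩ | ⟨h, D, hD, hz⟩
    · refine Or.inr ⟨by rw [h], _, mul_mem hE (map_mem_specialUnitaryGroup hD), fun z => ?_⟩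
      rw [← hmul, hz, smul_Mz_congr_map hv]
      rfl
    · refine Or.inl ⟨by rw [h, neg_neg], _, mul_mem hE (map_mem_specialUnitaryGroup hD),
        fun z => ?_⟩
      have := hmul ((Mz z).map (starRingEnd ℂ)) D
      rw [map_map_starRingEnd] at this
      rw [← this, hz, smul_Mz_congr_map hv]
      rfl

lemma det_and_exists_congr_of_isometry (R : (Fin 3 → ℂ) →ₗ[ℝ] (Fin 3 → ℂ))
    (hR : ∀ z : Fin 3 → ℂ, ∑ i, Complex.normSq (R z i) = ∑ i, Complex.normSq (z i)) :
    (LinearMap.det R = 1 ∧ ∃ D ∈ specialUnitaryGroup (Fin 4) ℂ, ∀ z : Fin 3 → ℂ,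
      D * Mz z * Dᵀ = Mz (R z)) ∨
    (LinearMap.det R = -1 ∧ ∃ D ∈ specialUnitaryGroup (Fin 4) ℂ, ∀ z : Fin 3 → ℂ,
      D * (Mz z).map (starRingEnd ℂ) * Dᵀ = Mz (R z)) := by
  let e : (Fin 3 → ℂ) ≃ₗ[ℝ] EuclideanSpace ℂ (Fin 3) := (WithLp.linearEquiv 2 ℝ (Fin 3 → ℂ)).symm
  let f : EuclideanSpace ℂ (Fin 3) →ₗᵢ[ℝ] EuclideanSpace ℂ (Fin 3) :=
    { toLinearMap := e ∘ₗ R ∘ₗ e.symm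
      norm_map' := fun z => by
        rw [← sq_eq_sq₀ (norm_nonneg _) (norm_nonneg _), ← sum_normSq_eq_norm_sq,
          ← sum_normSq_eq_norm_sq]
        exact hR z.ofLp }
  let φ := f.toLinearIsometryEquiv rfl
  have hdet : LinearMap.det φ.toLinearMap = LinearMap.det R := LinearMap.det_conj R e
  have hφ : ∀ z : Fin 3 → ℂ, (φ (WithLp.toLp 2 z)).ofLp = R z := fun _ => rfl
  obtain ⟨l, -, hl⟩ := φ.reflections_generate_dim
  have key := det_prod_reflection_and_exists_congr l
  rw [← hl, hdet] at key
  rcases key with ⟨h, D, hD, hz⟩ | ⟨h, D, hD, hz⟩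
  · exact Or.inl ⟨h, D, hD, fun z => hz (WithLp.toLp 2 z)⟩
  · exact Or.inr ⟨h, D, hD, fun z => hz (WithLp.toLp 2 z)⟩

lemma not_congr_Mz_eq_congr_map {D E : Matrix (Fin 4) (Fin 4) ℂ}
    (hE : E ∈ specialUnitaryGroup (Fin 4) ℂ)
    (h : ∀ z, D * Mz z * Dᵀ = E * (Mz z).map (starRingEnd ℂ) * Eᵀ) : False := by
  have h1 := (mem_specialUnitaryGroup_iff_map.mp hE).1
  have h2 := transpose_mul_map_of_mem hE
  obtain ⟨z, hz⟩ := exists_congr_Mz_ne_map ((E.map (starRingEnd ℂ))ᵀ * D)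
  apply hz
  calc _ = (E.map (starRingEnd ℂ))ᵀ * (D * Mz z * Dᵀ) * E.map (starRingEnd ℂ) := by
        simp only [transpose_mul, transpose_transpose, Matrix.mul_assoc]
    _ = ((E.map (starRingEnd ℂ))ᵀ * E) * (Mz z).map (starRingEnd ℂ) *
          (Eᵀ * E.map (starRingEnd ℂ)) := by
        rw [h]; simp only [Matrix.mul_assoc]
    _ = _ := by rw [h1, h2, Matrix.one_mul, Matrix.mul_one]

/-- **The double covering `SU(4) ≅ Spin(6) → SO(6)`.** Each `D ∈ SU(4)` determines a
unique map `ρ_D` with `D·M(z)·Dᵀ = M(ρ_D(z))`; it is `ℝ`-linear, norm-preserving and of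
determinant `1`; conversely every special orthogonal `ℝ`-linear map of `ℂ³ ≅ ℝ⁶` arises
this way. -/
theorem Mz_spin_covering :
    (∀ D : Matrix (Fin 4) (Fin 4) ℂ, (D.map (starRingEnd ℂ))ᵀ * D = 1 → D.det = 1 →
      ∃ ρ : (Fin 3 → ℂ) →ₗ[ℝ] (Fin 3 → ℂ),
        (∀ z : Fin 3 → ℂ, D * Mz z * Dᵀ = Mz (ρ z)) ∧
        (∀ ρ' : (Fin 3 → ℂ) → (Fin 3 → ℂ),
            (∀ z : Fin 3 → ℂ, D * Mz z * Dᵀ = Mz (ρ' z)) → ρ' = ⇑ρ) ∧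
        (∀ z : Fin 3 → ℂ, ∑ i, Complex.normSq (ρ z i) = ∑ i, Complex.normSq (z i)) ∧
        LinearMap.det ρ = 1) ∧
    (∀ R : (Fin 3 → ℂ) →ₗ[ℝ] (Fin 3 → ℂ),
      (∀ z : Fin 3 → ℂ, ∑ i, Complex.normSq (R z i) = ∑ i, Complex.normSq (z i)) →
      LinearMap.det R = 1 →
      ∃ D : Matrix (Fin 4) (Fin 4) ℂ, (D.map (starRingEnd ℂ))ᵀ * D = 1 ∧ D.det = 1 ∧
        ∀ z : Fin 3 → ℂ, D * Mz z * Dᵀ = Mz (R z)) := by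
  refine ⟨fun D hD hdet => ?_, fun R hR hdet => ?_⟩
  · have hDm := mem_specialUnitaryGroup_iff_map.mpr ⟨hD, hdet⟩
    let ρ : (Fin 3 → ℂ) →ₗ[ℝ] (Fin 3 → ℂ) :=
      { toFun := fun z =>
          ![(D * Mz z * Dᵀ) 3 0, (D * Mz z * Dᵀ) 2 0, (D * Mz z * Dᵀ) 1 0]
        map_add' := fun z w => by
          rw [Mz_add, Matrix.mul_add, Matrix.add_mul]
          ext i; fin_cases i <;> rfl
        map_smul' := fun a z => by
          rw [← smul_Mz, Matrix.mul_smul, Matrix.smul_mul]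
          ext i; fin_cases i <;> simp }
    have hρ : ∀ z, D * Mz z * Dᵀ = Mz (ρ z) := congr_Mz_eq_Mz hDm
    have hn : ∀ z : Fin 3 → ℂ, ∑ i, Complex.normSq (ρ z i) = ∑ i, Complex.normSq (z i) :=
      fun z => sum_normSq_eq_of_congr hDm (hρ z)
    refine ⟨ρ, hρ, fun ρ' h => funext fun z => Mz_injective ((h z).symm.trans (hρ z)), hn, ?_⟩
    rcases det_and_exists_congr_of_isometry ρ hn with ⟨h, -⟩ | ⟨-, E, hE, h⟩
    · exact h
    · exact (not_congr_Mz_eq_congr_map hE fun z => (hρ z).trans (h z).symm).elim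
  · rcases det_and_exists_congr_of_isometry R hR with ⟨-, D, hD, h⟩ | ⟨h, -⟩
    · obtain ⟨h1, h2⟩ := mem_specialUnitaryGroup_iff_map.mp hD
      exact ⟨D, h1, h2, h⟩
    · norm_num [hdet] at h
end
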